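/- arXiv:2102.00331 — 4 statements merged into one kernel-verified Lean document; each statement's English description precedes it below -/
import Mathlib

section
/- Let H be a complex Hilbert space, let g : [0,∞) → (0,∞) be non-increasing, and let f₂ : [0,∞) → H be locally Bochner integrable with ∫_0^∞ g(τ) ‖f₂(τ)‖² dτ < ∞. Define f₃(s) = ∫_0^s e^{τ−s} f₂(τ) dτ. Then ∫_0^∞ g(s) ‖f₃(s)‖² ds ≤ ∫_0^∞ g(τ) ‖f₂(τ)‖² dτ. -/
open MeasureTheory Filter Set

/-- Cauchy-Schwarz inequality for the weight `k`. -/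
theorem sq_lintegral_mul_le {α : Type*} [MeasurableSpace α] {μ : Measure α}
    {k F : α → ENNReal} (hk : AEMeasurable k μ) (hF : AEMeasurable F μ) :
    (∫⁻ a, k a * F a ∂μ) ^ 2 ≤ (∫⁻ a, k a ∂μ) * ∫⁻ a, k a * F a ^ 2 ∂μ := by
  have hsq : ∀ x : ENNReal, (x ^ (1 / 2 : ℝ)) ^ 2 = x := fun x => by
    rw [← ENNReal.rpow_natCast, ← ENNReal.rpow_mul]
    norm_num
  have hk' : AEMeasurable (fun a => k a ^ (1 / 2 : ℝ)) μ := hk.pow_const _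
  have h := ENNReal.lintegral_mul_le_Lp_mul_Lq μ Real.HolderConjugate.two_two hk' (hk'.mul hF)
  simp only [Pi.mul_apply, ENNReal.rpow_two, mul_pow, hsq, ← mul_assoc, ← sq] at h
  calc (∫⁻ a, k a * F a ∂μ) ^ 2 ≤ _ := pow_le_pow_left' h 2
    _ = _ := by rw [mul_pow, hsq, hsq]

/-- The causal exponential kernel `e^{τ-s}`, `τ ≤ s`. -/
noncomputable def causalExpKernel (s τ : ℝ) : ENNReal :=
  if τ ≤ s then ENNReal.ofReal (Real.exp (τ - s)) else 0

theorem measurable_causalExpKernel :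
    Measurable (Function.uncurry causalExpKernel) := by
  refine Measurable.ite (measurableSet_le measurable_snd measurable_fst) ?_ measurable_const
  fun_prop

theorem lintegral_causalExpKernel_right (s : ℝ) : ∫⁻ τ, causalExpKernel s τ = 1 := by
  have h : causalExpKernel s = (Iic s).indicator fun τ => ENNReal.ofReal (Real.exp (τ - s)) := rfl
  have he : (fun τ => Real.exp (τ - s)) = fun τ => Real.exp τ * Real.exp (-s) := by
    ext τ; rw [← Real.exp_add, sub_eq_add_neg]
  rw [h, lintegral_indicator measurableSet_Iic, ← ofReal_integral_eq_lintegral_ofReal, he,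
    integral_mul_const, integral_exp_Iic, ← Real.exp_add]
  · simp
  · rw [he]
    exact (integrableOn_exp_Iic s).mul_const _
  · exact ae_of_all _ fun _ => (Real.exp_pos _).le

theorem lintegral_causalExpKernel_left (τ : ℝ) : ∫⁻ s, causalExpKernel s τ = 1 := by
  have h : (fun s => causalExpKernel s τ) = fun s => causalExpKernel (-τ) (-s) := by
    ext s
    simp [causalExpKernel, sub_eq_add_neg, add_comm]
  rw [h, lintegral_neg_eq_self (causalExpKernel (-τ)), lintegral_causalExpKernel_right]

/-- For a positive non-increasing weight `g` and `f₂ : [0,∞) → H` locally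
Bochner integrable with `∫₀^∞ g ‖f₂‖² < ∞`, the function `f₃(s) = ∫₀^s e^{τ-s} f₂(τ) dτ`
satisfies `∫₀^∞ g(s) ‖f₃(s)‖² ds ≤ ∫₀^∞ g(τ) ‖f₂(τ)‖² dτ`. -/
theorem stmt3 {H : Type*} [NormedAddCommGroup H] [InnerProductSpace ℂ H] [CompleteSpace H]
    (g : ℝ → ℝ) (hgpos : ∀ s ∈ Set.Ici (0:ℝ), 0 < g s) (hganti : AntitoneOn g (Set.Ici 0))
    (f₂ : ℝ → H) (hf₂loc : MeasureTheory.LocallyIntegrableOn f₂ (Set.Ici 0))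
    (hf₂int : MeasureTheory.IntegrableOn (fun τ => g τ * ‖f₂ τ‖ ^ 2) (Set.Ioi 0))
    (f₃ : ℝ → H) (hf₃ : ∀ s : ℝ, f₃ s = ∫ τ in (0:ℝ)..s, Real.exp (τ - s) • f₂ τ) :
    (∫ s in Set.Ioi (0:ℝ), g s * ‖f₃ s‖ ^ 2) ≤ ∫ τ in Set.Ioi (0:ℝ), g τ * ‖f₂ τ‖ ^ 2 := by
  set μ := volume.restrict (Ioi (0:ℝ)) with hμ
  have hF : AEMeasurable (fun τ => ‖f₂ τ‖ₑ) μ :=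
    (hf₂loc.aestronglyMeasurable.mono_measure
      (Measure.restrict_mono Ioi_subset_Ici_self le_rfl)).enorm
  set G : ℝ → ENNReal := fun τ => ENNReal.ofReal (g τ * ‖f₂ τ‖ ^ 2) with hG
  have hGm : AEMeasurable G μ := hf₂int.aestronglyMeasurable.aemeasurable.ennreal_ofReal
  have hofReal : ∀ x ∈ Ioi (0:ℝ), ∀ v : H,
      ENNReal.ofReal (g x * ‖v‖ ^ 2) = ENNReal.ofReal (g x) * ‖v‖ₑ ^ 2 := fun x hx v => by
    rw [ENNReal.ofReal_mul (hgpos x (Ioi_subset_Ici_self hx)).le,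
      ENNReal.ofReal_pow (norm_nonneg _), ofReal_norm]
  have hK : ∀ s, Measurable (causalExpKernel s) := fun s =>
    measurable_causalExpKernel.of_uncurry_left
  have hnorm : ∀ s ∈ Ioi (0:ℝ), ‖f₃ s‖ₑ ≤ ∫⁻ τ, causalExpKernel s τ * ‖f₂ τ‖ₑ ∂μ := by
    intro s hs
    rw [hf₃, intervalIntegral.integral_of_le (le_of_lt hs)]
    refine (enorm_integral_le_lintegral_enorm _).trans ?_
    calc ∫⁻ τ in Ioc 0 s, ‖Real.exp (τ - s) • f₂ τ‖ₑ
        = ∫⁻ τ in Ioc 0 s, causalExpKernel s τ * ‖f₂ τ‖ₑ := by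
          refine setLIntegral_congr_fun measurableSet_Ioc fun τ hτ => ?_
          simp only [causalExpKernel, if_pos hτ.2, enorm_smul]
          rw [Real.enorm_of_nonneg (Real.exp_pos _).le]
      _ ≤ _ := lintegral_mono_set Ioc_subset_Ioi_self
  have hpoint : ∀ s ∈ Ioi (0:ℝ),
      ENNReal.ofReal (g s * ‖f₃ s‖ ^ 2) ≤ ∫⁻ τ, causalExpKernel s τ * G τ ∂μ := by
    intro s hs
    have hmass : ∫⁻ τ, causalExpKernel s τ ∂μ ≤ 1 :=
      (setLIntegral_le_lintegral _ _).trans (lintegral_causalExpKernel_right s).le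
    calc ENNReal.ofReal (g s * ‖f₃ s‖ ^ 2)
        = ENNReal.ofReal (g s) * ‖f₃ s‖ₑ ^ 2 := hofReal s hs _
      _ ≤ ENNReal.ofReal (g s) * ∫⁻ τ, causalExpKernel s τ * ‖f₂ τ‖ₑ ^ 2 ∂μ := by
          gcongr
          refine (pow_le_pow_left' (hnorm s hs) 2).trans
            ((sq_lintegral_mul_le (hK s).aemeasurable hF).trans ?_)
          exact mul_le_of_le_one_left' hmass
      _ = ∫⁻ τ, ENNReal.ofReal (g s) * (causalExpKernel s τ * ‖f₂ τ‖ₑ ^ 2) ∂μ :=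
          (lintegral_const_mul' _ _ ENNReal.ofReal_ne_top).symm
      _ ≤ ∫⁻ τ, causalExpKernel s τ * G τ ∂μ := by
          refine setLIntegral_mono' measurableSet_Ioi fun τ hτ => ?_
          rw [hG, mul_left_comm]
          simp only [hofReal τ hτ]
          by_cases h : τ ≤ s
          · gcongr
            exact hganti (Ioi_subset_Ici_self hτ) (Ioi_subset_Ici_self hs) h
          · simp [causalExpKernel, h]
  have hmain : ∫⁻ s, ENNReal.ofReal (g s * ‖f₃ s‖ ^ 2) ∂μ ≤ ∫⁻ τ, G τ ∂μ := by
    calc ∫⁻ s, ENNReal.ofReal (g s * ‖f₃ s‖ ^ 2) ∂μ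
        ≤ ∫⁻ s, ∫⁻ τ, causalExpKernel s τ * G τ ∂μ ∂μ :=
          setLIntegral_mono' measurableSet_Ioi hpoint
      _ = ∫⁻ τ, ∫⁻ s, causalExpKernel s τ * G τ ∂μ ∂μ :=
          lintegral_lintegral_swap (measurable_causalExpKernel.aemeasurable.mul hGm.comp_snd)
      _ ≤ ∫⁻ τ, G τ ∂μ := by
          refine lintegral_mono fun τ => ?_
          rw [lintegral_mul_const _ measurable_causalExpKernel.of_uncurry_right]
          exact mul_le_of_le_one_left'
            ((setLIntegral_le_lintegral _ _).trans (lintegral_causalExpKernel_left τ).le)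
  have hnonneg : ∀ v : ℝ → H, 0 ≤ᵐ[μ] fun s => g s * ‖v s‖ ^ 2 := fun v =>
    (ae_restrict_mem measurableSet_Ioi).mono fun s hs =>
      mul_nonneg (hgpos s (Ioi_subset_Ici_self hs)).le (sq_nonneg _)
  have hfin : ∫⁻ τ, G τ ∂μ ≠ ⊤ := hf₂int.lintegral_lt_top.ne
  calc ∫ s, g s * ‖f₃ s‖ ^ 2 ∂μ
      ≤ (∫⁻ s, ENNReal.ofReal ‖g s * ‖f₃ s‖ ^ 2‖ ∂μ).toReal :=
        (Real.le_norm_self _).trans (norm_integral_le_lintegral_norm _)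
    _ = (∫⁻ s, ENNReal.ofReal (g s * ‖f₃ s‖ ^ 2) ∂μ).toReal := by
        congr 1
        refine lintegral_congr_ae ((hnonneg f₃).mono fun s hs => ?_)
        simp only [Real.norm_of_nonneg hs]
    _ ≤ (∫⁻ τ, G τ ∂μ).toReal := ENNReal.toReal_mono hfin hmain
    _ = ∫ τ, g τ * ‖f₂ τ‖ ^ 2 ∂μ :=
        (integral_eq_lintegral_of_nonneg_ae (hnonneg f₂) hf₂int.aestronglyMeasurable).symm
end

section
/- Let G : [0,∞) → [0,∞) be an increasing strictly convex function of class C¹ on [0,∞) and C² on (0,∞) with G(0) = G′(0) = 0 and lim_{t→∞} G′(t) = ∞. Let g : [0,∞) → (0,∞) be a C¹ non-increasing function with g′(s) < 0 for all s > 0, and let m₀ > 0 satisfy g(s) ≤ m₀ · G⁻¹(−g′(s)) for all s > 0. Let h, M : [0,∞) → [0,∞) be measurable with h(s) ≤ M(s) for all s, and assume m₁ := ∫_0^∞ M(s) g(s) / G⁻¹(−g′(s)) ds < ∞ and ∫_0^∞ (−g′(s)) h(s) ds < ∞. Then for every λ > 0: ∫_0^∞ g(s) h(s) ds ≤ (m₀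 / G′(λ)) ∫_0^∞ (−g′(s)) h(s) ds + m₁ λ. -/
open Set Filter MeasureTheory

/-- A convex function lies above its tangent lines. -/
theorem ConvexOn.tangent_le_of_hasDerivAt {S : Set ℝ} {f : ℝ → ℝ} {a x y : ℝ}
    (hf : ConvexOn ℝ S f) (hx : x ∈ S) (hy : y ∈ S) (hd : HasDerivAt f a x) :
    f x + a * (y - x) ≤ f y := by
  rcases lt_trichotomy x y with hxy | rfl | hxy
  · have := hf.le_slope_of_hasDerivAt hx hy hxy hd
    rw [slope_def_field, le_div_iff₀ (sub_pos.2 hxy)] at this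
    linarith
  · simp
  · have := hf.slope_le_of_hasDerivAt hy hx hxy hd
    rw [slope_def_field, div_le_iff₀ (sub_pos.2 hxy)] at this
    linarith

/-- Weighted estimate: under the hypotheses on `G` (increasing, strictly convex,
`C¹` on `[0,∞)`, `C²` on `(0,∞)`, `G(0) = G'(0) = 0`, `G'(t) → ∞`), a kernel `g > 0`,
non-increasing, `C¹` with `g' < 0` on `(0,∞)` and `g(s) ≤ m₀ G⁻¹(-g'(s))`, and measurable
`h ≤ M` with `m₁ = ∫₀^∞ M g / G⁻¹(-g') < ∞` and `∫₀^∞ (-g') h < ∞`, one has, for every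
`λ > 0`, `∫₀^∞ g h ≤ (m₀ / G'(λ)) ∫₀^∞ (-g') h + m₁ λ`. -/
theorem stmt9 (G G' G'' Ginv : ℝ → ℝ)
    (hGmono : MonotoneOn G (Set.Ici 0))
    (hGconv : StrictConvexOn ℝ (Set.Ici 0) G)
    (hGnonneg : ∀ s ∈ Set.Ici (0:ℝ), 0 ≤ G s)
    (hG' : ∀ s ∈ Set.Ici (0:ℝ), HasDerivWithinAt G (G' s) (Set.Ici 0) s)
    (hG'cont : ContinuousOn G' (Set.Ici 0))
    (hG'' : ∀ s ∈ Set.Ioi (0:ℝ), HasDerivAt G' (G'' s) s)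
    (hG''cont : ContinuousOn G'' (Set.Ioi 0))
    (hG0 : G 0 = 0) (hG'0 : G' 0 = 0)
    (hG'inf : Filter.Tendsto G' Filter.atTop Filter.atTop)
    (hGinv1 : ∀ s ∈ Set.Ici (0:ℝ), Ginv s ∈ Set.Ici (0:ℝ) ∧ G (Ginv s) = s)
    (hGinv2 : ∀ s ∈ Set.Ici (0:ℝ), Ginv (G s) = s)
    (g g' : ℝ → ℝ)
    (hgpos : ∀ s ∈ Set.Ici (0:ℝ), 0 < g s)
    (hganti : AntitoneOn g (Set.Ici 0))
    (hg' : ∀ s ∈ Set.Ici (0:ℝ), HasDerivWithinAt g (g' s) (Set.Ici 0) s)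
    (hg'cont : ContinuousOn g' (Set.Ici 0))
    (hg'neg : ∀ s : ℝ, 0 < s → g' s < 0)
    (m₀ : ℝ) (hm₀ : 0 < m₀)
    (hgm₀ : ∀ s : ℝ, 0 < s → g s ≤ m₀ * Ginv (-(g' s)))
    (h M : ℝ → ℝ) (hhmeas : Measurable h) (hMmeas : Measurable M)
    (hhnn : ∀ s ∈ Set.Ici (0:ℝ), 0 ≤ h s) (hMnn : ∀ s ∈ Set.Ici (0:ℝ), 0 ≤ M s)
    (hhM : ∀ s ∈ Set.Ici (0:ℝ), h s ≤ M s)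
    (m₁ : ℝ)
    (hm₁int : MeasureTheory.IntegrableOn (fun s => M s * g s / Ginv (-(g' s))) (Set.Ioi 0))
    (hm₁ : (∫ s in Set.Ioi (0:ℝ), M s * g s / Ginv (-(g' s))) = m₁)
    (hg'hint : MeasureTheory.IntegrableOn (fun s => (-(g' s)) * h s) (Set.Ioi 0)) :
    ∀ lam : ℝ, 0 < lam →
      (∫ s in Set.Ioi (0:ℝ), g s * h s) ≤
        (m₀ / G' lam) * (∫ s in Set.Ioi (0:ℝ), (-(g' s)) * h s) + m₁ * lam := by
  intro lam hlam
  have tangent : ∀ t, 0 ≤ t → G lam + G' lam * (t - lam) ≤ G t := fun t ht =>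
    hGconv.convexOn.tangent_le_of_hasDerivAt (mem_Ici.2 hlam.le) (mem_Ici.2 ht)
      ((hG' lam hlam.le).hasDerivAt (Ici_mem_nhds hlam))
  have hGlam : 0 < G lam := by
    have h1 := hGconv.2 (mem_Ici.2 le_rfl) (mem_Ici.2 hlam.le) hlam.ne
      (by norm_num : (0 : ℝ) < 1 / 2) (by norm_num : (0 : ℝ) < 1 / 2) (by norm_num)
    have h2 := hGnonneg ((1 / 2 : ℝ) • 0 + (1 / 2 : ℝ) • lam)
      (by simp only [smul_eq_mul, mem_Ici]; linarith)
    simp only [smul_eq_mul, hG0] at h1 h2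
    linarith
  have hG'lam : 0 < G' lam := by
    have := tangent 0 le_rfl
    rw [hG0] at this
    by_contra! hneg
    nlinarith
  have pointwise : ∀ s : ℝ, 0 < s →
      g s * h s ≤ m₀ / G' lam * (-(g' s) * h s) + M s * g s / Ginv (-(g' s)) * lam := by
    intro s hs
    have hneg : 0 < -(g' s) := neg_pos.2 (hg'neg s hs)
    obtain ⟨ht0, hGt⟩ := hGinv1 (-(g' s)) hneg.le
    have hgm := hgm₀ s hs
    have hg0 := hgpos s hs.le
    have hh0 := hhnn s hs.le
    have hhM' := hhM s hs.le
    set t := Ginv (-(g' s))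
    have ht : 0 < t := by
      refine lt_of_le_of_ne ht0 fun h0 => ?_
      rw [← h0, hG0] at hGt
      linarith
    have young : t * G' lam ≤ G t + lam * G' lam := by linarith [tangent t ht0]
    rw [← hGt]
    have hGt0 : 0 ≤ G t := hGnonneg t ht0
    calc g s * h s = g s * h s / (t * G' lam) * (t * G' lam) := by field_simp
      _ ≤ g s * h s / (t * G' lam) * (G t + lam * G' lam) := by gcongr
      _ = g s / t / G' lam * (G t * h s) + h s * g s / t * lam := by field_simp
      _ ≤ m₀ / G' lam * (G t * h s) + M s * g s / t * lam := by
        have : g s / t ≤ m₀ := (div_le_iff₀ ht).2 hgm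
        gcongr
  rw [← hm₁, ← integral_const_mul, ← integral_mul_const,
    ← integral_add (hg'hint.const_mul _) (hm₁int.mul_const _)]
  refine integral_mono_of_nonneg ?_ ((hg'hint.const_mul _).add (hm₁int.mul_const _)) ?_
  · filter_upwards [ae_restrict_mem measurableSet_Ioi] with s hs
    exact mul_nonneg (hgpos s (mem_Ioi.1 hs).le).le (hhnn s (mem_Ioi.1 hs).le)
  · filter_upwards [ae_restrict_mem measurableSet_Ioi] with s hs
    exact pointwise s hs
end

section
/- Let G₀ : [0,∞) → [0,∞) be a continuous strictly increasing bijection of [0,∞) onto itself, let ε₀, c > 0, let E : [0,∞) → [0,∞) be non-increasing, and let V : [0,∞) → [0,∞) be non-increasing and differentiable, with G₀(ε₀ E(t)) ≤ −c V′(t) for all t ≥ 0. Then for every t > 0: E(t) ≤ (1/ε₀) · G₀⁻¹(c V(0) / t). -/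
open Set Filter

/-- If `G₀` is a continuous strictly increasing bijection of `[0,∞)` onto
itself, `E ≥ 0` non-increasing, `V ≥ 0` non-increasing and differentiable with
`G₀(ε₀ E(t)) ≤ -c V'(t)` for all `t ≥ 0`, then `E(t) ≤ (1/ε₀) G₀⁻¹(c V(0) / t)` for `t > 0`. -/
theorem stmt10 (G₀ G₀inv : ℝ → ℝ)
    (hbij : Set.BijOn G₀ (Set.Ici 0) (Set.Ici 0))
    (hmono : StrictMonoOn G₀ (Set.Ici 0))
    (hcont : ContinuousOn G₀ (Set.Ici 0))
    (hinv1 : ∀ s ∈ Set.Ici (0:ℝ), G₀inv s ∈ Set.Ici (0:ℝ) ∧ G₀ (G₀inv s) = s)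
    (hinv2 : ∀ s ∈ Set.Ici (0:ℝ), G₀inv (G₀ s) = s)
    (ε₀ c : ℝ) (hε₀ : 0 < ε₀) (hc : 0 < c)
    (E V V' : ℝ → ℝ)
    (hEnn : ∀ t ∈ Set.Ici (0:ℝ), 0 ≤ E t) (hEanti : AntitoneOn E (Set.Ici 0))
    (hVnn : ∀ t ∈ Set.Ici (0:ℝ), 0 ≤ V t) (hVanti : AntitoneOn V (Set.Ici 0))
    (hV' : ∀ t ∈ Set.Ici (0:ℝ), HasDerivWithinAt V (V' t) (Set.Ici 0) t)
    (hineq : ∀ t ∈ Set.Ici (0:ℝ), G₀ (ε₀ * E t) ≤ -c * V' t) :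
    ∀ t : ℝ, 0 < t → E t ≤ (1 / ε₀) * G₀inv (c * V 0 / t) := by
  intro t ht
  have hsub : Set.Icc 0 t ⊆ Set.Ici (0:ℝ) := fun x hx => hx.1
  obtain ⟨ξ, hξ, hslope⟩ := exists_hasDerivAt_eq_slope V V' ht
    (fun x hx => ((hV' x (hsub hx)).continuousWithinAt).mono hsub)
    (fun x hx => (hV' x hx.1.le).hasDerivAt (Ici_mem_nhds hx.1))
  have hξ0 : ξ ∈ Set.Ici (0:ℝ) := hξ.1.le
  have ht0 : t ∈ Set.Ici (0:ℝ) := ht.le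
  have hq : c * V 0 / t ∈ Set.Ici (0:ℝ) :=
    div_nonneg (mul_nonneg hc.le (hVnn 0 Set.self_mem_Ici)) ht.le
  obtain ⟨hmem, hG⟩ := hinv1 _ hq
  have hεE : ∀ s ∈ Set.Ici (0:ℝ), ε₀ * E s ∈ Set.Ici (0:ℝ) :=
    fun s hs => mul_nonneg hε₀.le (hEnn s hs)
  have hle : G₀ (ε₀ * E t) ≤ G₀ (G₀inv (c * V 0 / t)) := by
    calc G₀ (ε₀ * E t) ≤ G₀ (ε₀ * E ξ) :=
          hmono.monotoneOn (hεE t ht0) (hεE ξ hξ0)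
            (mul_le_mul_of_nonneg_left (hEanti hξ0 ht0 hξ.2.le) hε₀.le)
      _ ≤ -c * V' ξ := hineq ξ hξ0
      _ = c * (V 0 - V t) / t := by rw [hslope, sub_zero]; ring
      _ ≤ c * V 0 / t := by
          gcongr
          linarith [hVnn t ht0]
      _ = G₀ (G₀inv (c * V 0 / t)) := hG.symm
  rw [one_div, ← div_eq_inv_mul, le_div_iff₀' hε₀]
  exact (hmono.le_iff_le (hεE t ht0) hmem).1 hle
end

section
/- Let G₀ : [0,∞) → [0,∞) be a continuous strictly increasing bijection of [0,∞) onto itself, let ε₀, c > 0, let E : [0,∞) → [0,∞) be non-increasing, let V : [0,∞) → [0,∞) be non-increasing and differentiable with G₀(ε₀ E(t)) ≤ −c V′(t) for all t ≥ 0, and let Φ : (0,∞) → [0,∞) satisfy V(T) ≤ Φ(T) for all T > 0. Then for every t > 0: E(t) ≤ (1/ε₀) · G₀⁻¹((2c/t) · Φ(t/2)). -/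
open Set Filter

/-- Iteration step: under the hypotheses of the basic decay lemma, if moreover
`V(T) ≤ Φ(T)` for all `T > 0`, then `E(t) ≤ (1/ε₀) G₀⁻¹((2c/t) Φ(t/2))` for all `t > 0`. -/
theorem stmt11 (G₀ G₀inv : ℝ → ℝ)
    (hbij : Set.BijOn G₀ (Set.Ici 0) (Set.Ici 0))
    (hmono : StrictMonoOn G₀ (Set.Ici 0))
    (hcont : ContinuousOn G₀ (Set.Ici 0))
    (hinv1 : ∀ s ∈ Set.Ici (0:ℝ), G₀inv s ∈ Set.Ici (0:ℝ) ∧ G₀ (G₀inv s) = s)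
    (hinv2 : ∀ s ∈ Set.Ici (0:ℝ), G₀inv (G₀ s) = s)
    (ε₀ c : ℝ) (hε₀ : 0 < ε₀) (hc : 0 < c)
    (E V V' : ℝ → ℝ)
    (hEnn : ∀ t ∈ Set.Ici (0:ℝ), 0 ≤ E t) (hEanti : AntitoneOn E (Set.Ici 0))
    (hVnn : ∀ t ∈ Set.Ici (0:ℝ), 0 ≤ V t) (hVanti : AntitoneOn V (Set.Ici 0))
    (hV' : ∀ t ∈ Set.Ici (0:ℝ), HasDerivWithinAt V (V' t) (Set.Ici 0) t)
    (hineq : ∀ t ∈ Set.Ici (0:ℝ), G₀ (ε₀ * E t) ≤ -c * V' t)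
    (Φ : ℝ → ℝ) (hΦnn : ∀ T : ℝ, 0 < T → 0 ≤ Φ T)
    (hVΦ : ∀ T : ℝ, 0 < T → V T ≤ Φ T) :
    ∀ t : ℝ, 0 < t → E t ≤ (1 / ε₀) * G₀inv ((2 * c / t) * Φ (t / 2)) := by
  intro t ht
  have ht0 : t ∈ Ici (0:ℝ) := ht.le
  have hsub : ∀ x ∈ Icc (t / 2) t, x ∈ Ici (0:ℝ) := fun x hx =>
    (half_pos ht).le.trans hx.1
  obtain ⟨ξ, hξ, hξV⟩ : ∃ ξ ∈ Ioo (t / 2) t, V' ξ = (V t - V (t / 2)) / (t - t / 2) :=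
    exists_hasDerivAt_eq_slope V V' (half_lt_self ht)
      (fun x hx => ((hV' x (hsub x hx)).continuousWithinAt).mono hsub)
      (fun x hx => (hV' x (hsub x (Ioo_subset_Icc_self hx))).hasDerivAt
        (Ici_mem_nhds ((half_pos ht).trans hx.1)))
  have hξ0 : ξ ∈ Ici (0:ℝ) := hsub ξ (Ioo_subset_Icc_self hξ)
  have hEt : ε₀ * E t ∈ Ici (0:ℝ) := mul_nonneg hε₀.le (hEnn t ht0)
  have hEξ : ε₀ * E ξ ∈ Ici (0:ℝ) := mul_nonneg hε₀.le (hEnn ξ hξ0)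
  have hG : G₀ (ε₀ * E t) ≤ 2 * c / t * Φ (t / 2) := calc
    G₀ (ε₀ * E t) ≤ G₀ (ε₀ * E ξ) := hmono.monotoneOn hEt hEξ
      (mul_le_mul_of_nonneg_left (hEanti hξ0 ht0 hξ.2.le) hε₀.le)
    _ ≤ -c * V' ξ := hineq ξ hξ0
    _ = 2 * c / t * (V (t / 2) - V t) := by rw [hξV, sub_half]; field_simp; ring
    _ ≤ 2 * c / t * Φ (t / 2) := by
      refine mul_le_mul_of_nonneg_left ?_ (by positivity)
      linarith [hVΦ (t / 2) (half_pos ht), hVnn t ht0]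
  obtain ⟨hinv0, hinvG⟩ := hinv1 (2 * c / t * Φ (t / 2))
    (mul_nonneg (by positivity) (hΦnn _ (half_pos ht)))
  rw [← hinvG] at hG
  have hle := (hmono.le_iff_le hEt hinv0).mp hG
  rwa [one_div, le_inv_mul_iff₀ hε₀]
end
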